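/- arXiv:1012.5493 — 2 statements merged into one kernel-verified Lean document; each statement's English description precedes it below -/
import Mathlib

section
/- Let α be irrational and let 0 ≤ n₁ < n₂ < n₃ be integers such that n₃ is the smallest positive integer j for which jα (mod 1) lies in the open arc of shorter length in ℝ/ℤ bounded by the points n₁α (mod 1) and n₂α (mod 1). Then n₃ − n₂ is a closest return time for α, i.e. ‖jα‖ > ‖(n₃−n₂)α‖ for every integer j with 0 < j < n₃ − n₂. -/
open Filter Topology

noncomputable section

/-- `q` is a closest return time for `α`: `‖jα‖ > ‖qα‖` for every `0 < j < q`, where `‖·‖`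
is the distance to the nearest integer. -/
def IsClosestReturnTime (α : ℝ) (q : ℕ) : Prop :=
  0 < q ∧ ∀ j : ℕ, 0 < j → j < q →
    ‖(((j : ℝ) * α : ℝ) : AddCircle (1 : ℝ))‖ > ‖(((q : ℝ) * α : ℝ) : AddCircle (1 : ℝ))‖

/-- `w` lies on the open arc of shorter length bounded by the distinct points `u, v` of
`ℝ/ℤ`.  Since `dist u v` is the length of the shorter arc, this is characterized by the
triangle equality `dist u w + dist w v = dist u v` together with `w ≠ u`, `w ≠ v`. -/
def MemShortArc (u v w : AddCircle (1 : ℝ)) : Prop :=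
  w ≠ u ∧ w ≠ v ∧ dist u w + dist w v = dist u v

/-- Every point of `ℝ/ℤ` has a real representative whose absolute value is its norm. -/
theorem exists_coe_eq_abs_eq_norm (z : AddCircle (1 : ℝ)) :
    ∃ x : ℝ, (x : AddCircle (1 : ℝ)) = z ∧ |x| = ‖z‖ := by
  induction z using QuotientAddGroup.induction_on with
  | H t =>
    refine ⟨t - round t, ?_, ?_⟩
    · rw [AddCircle.coe_sub, sub_eq_self]
      exact AddCircle.coe_eq_zero_iff (1 : ℝ) |>.2 ⟨round t, by simp⟩
    · exact (UnitAddCircle.norm_eq (x := t)).symm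

theorem norm_coe_le_abs (x : ℝ) : ‖(x : AddCircle (1 : ℝ))‖ ≤ |x| := by
  rw [UnitAddCircle.norm_eq]
  simpa using round_le x 0

/-- A displacement `y` no longer than `d` points either along `d` or along `-d`. -/
theorem norm_sub_add_norm_eq_or_norm_add_add_norm_eq {d y : AddCircle (1 : ℝ)}
    (h : ‖y‖ ≤ ‖d‖) : ‖d - y‖ + ‖y‖ = ‖d‖ ∨ ‖d + y‖ + ‖y‖ = ‖d‖ := by
  obtain ⟨a, rfl, ha⟩ := exists_coe_eq_abs_eq_norm d
  obtain ⟨b, rfl, hb⟩ := exists_coe_eq_abs_eq_norm y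
  have hsub := norm_coe_le_abs (a - b)
  have hadd := norm_coe_le_abs (a + b)
  rw [AddCircle.coe_sub] at hsub
  rw [AddCircle.coe_add] at hadd
  have hsub' := norm_le_norm_sub_add (a : AddCircle (1 : ℝ)) b
  have hadd' := norm_sub_le ((a : AddCircle (1 : ℝ)) + b) b
  rw [add_sub_cancel_right] at hadd'
  have hreal : |a - b| + |b| = |a| ∨ |a + b| + |b| = |a| := by
    rw [← ha, ← hb] at h
    grind
  rcases hreal with hr | hr
  · left; linarith
  · right; linarith

theorem coe_natCast_mul_ne_zero {α : ℝ} (hα : Irrational α) {j : ℕ} (hj : 0 < j) :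
    (((j : ℝ) * α : ℝ) : AddCircle (1 : ℝ)) ≠ 0 := by
  intro h
  obtain ⟨n, hn⟩ := (AddCircle.coe_eq_zero_iff (1 : ℝ)).1 h
  exact (hα.natCast_mul hj.ne').ne_int n (by simpa using hn.symm)

/-- If `y ≠ 0` is shorter than `u - v`, then translating `u` or `v` by `y` enters the short arc
bounded by `u` and `v`. -/
theorem memShortArc_add_or {u v y : AddCircle (1 : ℝ)} (hy : y ≠ 0) (h : ‖y‖ < ‖u - v‖) :
    MemShortArc u v (v + y) ∨ MemShortArc u v (u + y) := by
  rcases norm_sub_add_norm_eq_or_norm_add_add_norm_eq h.le with hd | hd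
  · refine Or.inl ⟨?_, by simpa using hy, ?_⟩
    · rintro rfl
      simp at h
    · rwa [dist_eq_norm, dist_eq_norm, dist_eq_norm, add_sub_cancel_left, ← sub_sub]
  · refine Or.inr ⟨by simpa using hy, ?_, ?_⟩
    · rintro rfl
      rw [sub_add_cancel_left, norm_neg] at h
      exact h.false
    · rwa [dist_eq_norm, dist_eq_norm, dist_eq_norm, sub_add_cancel_left, norm_neg,
        add_sub_right_comm, add_comm]

/-- If `n₃` is the smallest positive integer `j` such that `jα` lies in the open shorter arc
bounded by `n₁α` and `n₂α` (with `n₁ < n₂ < n₃`), then `n₃ − n₂` is a closest return time. -/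
theorem stmt_8 (α : ℝ) (hα : Irrational α) (n₁ n₂ n₃ : ℕ)
    (h12 : n₁ < n₂) (h23 : n₂ < n₃)
    (harc : MemShortArc (((n₁ : ℝ) * α : ℝ) : AddCircle (1 : ℝ))
      (((n₂ : ℝ) * α : ℝ) : AddCircle (1 : ℝ)) (((n₃ : ℝ) * α : ℝ) : AddCircle (1 : ℝ)))
    (hmin : ∀ j : ℕ, 0 < j →
      MemShortArc (((n₁ : ℝ) * α : ℝ) : AddCircle (1 : ℝ))
        (((n₂ : ℝ) * α : ℝ) : AddCircle (1 : ℝ)) (((j : ℝ) * α : ℝ) : AddCircle (1 : ℝ)) →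
      n₃ ≤ j) :
    IsClosestReturnTime α (n₃ - n₂) := by
  refine ⟨Nat.sub_pos_of_lt h23, fun j hj hjq => ?_⟩
  by_contra! hle
  have hcoe (m k : ℕ) : (((m + k : ℕ) : ℝ) * α : ℝ) =
      (((m : ℝ) * α : ℝ) : AddCircle (1 : ℝ)) + (((k : ℝ) * α : ℝ) : AddCircle (1 : ℝ)) := by
    rw [← AddCircle.coe_add]; push_cast; ring_nf
  obtain ⟨hne, -, hdist⟩ := harc
  have hpos := dist_pos.2 hne.symm
  have hn₃ := hcoe n₂ (n₃ - n₂)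
  rw [Nat.add_sub_cancel' h23.le] at hn₃
  have hq : dist (((n₃ : ℝ) * α : ℝ) : AddCircle (1 : ℝ)) (((n₂ : ℝ) * α : ℝ)) =
      ‖((((n₃ - n₂ : ℕ) : ℝ) * α : ℝ) : AddCircle (1 : ℝ))‖ := by
    rw [hn₃, dist_eq_norm, add_sub_cancel_left]
  have hlt : ‖(((j : ℝ) * α : ℝ) : AddCircle (1 : ℝ))‖ <
      ‖(((n₁ : ℝ) * α : ℝ) : AddCircle (1 : ℝ)) - (((n₂ : ℝ) * α : ℝ))‖ := by
    rw [← dist_eq_norm]; linarith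
  rcases memShortArc_add_or (coe_natCast_mul_ne_zero hα hj) hlt with h | h
  · rw [← hcoe] at h
    have := hmin _ (by omega) h
    omega
  · rw [← hcoe] at h
    have := hmin _ (by omega) h
    omega
end
end

section
/- Let F = F_{α,φ} be an Anzai skew product satisfying conditions (3.1)–(3.4). Then for every x ∈ ℝ/ℤ and all real numbers 0 < a < b, the set 𝓛_x intersects [−b,−a] ∪ [a,b]; i.e. 𝓛_x ∩ ([−b,−a] ∪ [a,b]) ≠ ∅. -/
open Filter Topology MeasureTheory

noncomputable section

/-- The Anzai skew product `F(x,y) = (x+α, y+φ(x))` on `(ℝ/ℤ) × ℝ`, as a bijection. -/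
def anzai (α : ℝ) (φ : AddCircle (1 : ℝ) → ℝ) : Equiv.Perm (AddCircle (1 : ℝ) × ℝ) where
  toFun z := (z.1 + (α : AddCircle (1 : ℝ)), z.2 + φ z.1)
  invFun z := (z.1 - (α : AddCircle (1 : ℝ)), z.2 - φ (z.1 - (α : AddCircle (1 : ℝ))))
  left_inv z := by simp
  right_inv z := by simp

/-- The limit set `λ(z)` of a point `z` under the Anzai skew product: all limits of sequences
`F^{n_k}(z)` with `|n_k| → ∞` (the union of the α-limit and ω-limit sets). -/
def limitSet (α : ℝ) (φ : AddCircle (1 : ℝ) → ℝ) (z : AddCircle (1 : ℝ) × ℝ) :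
    Set (AddCircle (1 : ℝ) × ℝ) :=
  {w | ∃ n : ℕ → ℤ, Tendsto (fun k => |n k|) atTop atTop ∧
    Tendsto (fun k => ((anzai α φ) ^ (n k)) z) atTop (𝓝 w)}

/-- Poincaré's set `𝓛_x = { y ∈ ℝ : (x,y) ∈ λ(x,0) }`. -/
def Lx (α : ℝ) (φ : AddCircle (1 : ℝ) → ℝ) (x : AddCircle (1 : ℝ)) : Set ℝ :=
  {y | ((x, y) : AddCircle (1 : ℝ) × ℝ) ∈ limitSet α φ (x, 0)}

/-- `φ : ℝ/ℤ → ℝ` is absolutely continuous: there is `g ∈ L¹` with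
`φ(x) − φ(0) = ∫₀ˣ g(t) dt` for all `x ∈ [0,1]`. -/
def AbsolutelyContinuous' (φ : AddCircle (1 : ℝ) → ℝ) : Prop :=
  ∃ g : ℝ → ℝ, IntegrableOn g (Set.Icc 0 1) ∧
    ∀ x ∈ Set.Icc (0 : ℝ) 1, φ (x : ℝ) - φ ((0 : ℝ) : AddCircle (1 : ℝ)) = ∫ t in (0 : ℝ)..x, g t

/-- Conditions (3.1)–(3.4): `α` irrational, `φ` continuous with zero mean, the cohomological
equation `h ∘ R_α − h = φ` has no continuous solution, and `φ` is absolutely continuous. -/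
def AnzaiConds (α : ℝ) (φ : AddCircle (1 : ℝ) → ℝ) : Prop :=
  Irrational α ∧ Continuous φ ∧ (∫ x : AddCircle (1 : ℝ), φ x = 0) ∧
  (¬ ∃ h : AddCircle (1 : ℝ) → ℝ, Continuous h ∧
      ∀ x, h (x + (α : AddCircle (1 : ℝ))) - h x = φ x) ∧
  AbsolutelyContinuous' φ

/-- `q` is the denominator of a reduced fraction `p / q` with `|q α - p| ≤ 1 / q`. -/
def IsGoodApprox (α : ℝ) (q : ℕ) (p : ℤ) : Prop :=
  0 < q ∧ IsCoprime p (q : ℤ) ∧ |q * α - p| ≤ 1 / q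

theorem IsGoodApprox.neg {α : ℝ} {q : ℕ} {p : ℤ} (h : IsGoodApprox α q p) :
    IsGoodApprox (-α) q (-p) := by
  refine ⟨h.1, h.2.1.neg_left, ?_⟩
  have : (q : ℝ) * -α - ((-p : ℤ) : ℝ) = -(q * α - p) := by push_cast; ring
  rw [this, abs_neg]
  exact h.2.2

theorem exists_isGoodApprox {α : ℝ} {ε : ℝ} (hε : 0 < ε) :
    ∃ q : ℕ, ∃ p : ℤ, IsGoodApprox α q p ∧ |q * α - p| < ε ∧ |q * α - p| < 1 / q := by
  obtain ⟨n, hn⟩ := exists_nat_one_div_lt hε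
  obtain ⟨r, hr, hd⟩ := Real.exists_rat_abs_sub_le_and_den_le α (Nat.succ_pos n)
  have hq : (0 : ℝ) < r.den := by exact_mod_cast r.pos
  have hqn : (r.den : ℝ) ≤ n + 1 := by exact_mod_cast hd
  have key : |r.den * α - r.num| ≤ 1 / (n + 1 + 1) := by
    have h1 : (r.den : ℝ) * α - r.num = r.den * (α - r) := by
      have : (r.den : ℝ) * (r : ℝ) = r.num := by exact_mod_cast Rat.den_mul_eq_num r
      rw [mul_sub, this]
    rw [h1, abs_mul, abs_of_pos hq]
    calc (r.den : ℝ) * |α - r| ≤ r.den * (1 / (((n.succ : ℕ) + 1 : ℝ) * r.den)) := by gcongr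
      _ = 1 / (n + 1 + 1) := by push_cast; field_simp
  have h2 : (1 : ℝ) / (n + 1 + 1) < 1 / r.den := by
    apply one_div_lt_one_div_of_lt hq; linarith
  refine ⟨r.den, r.num, ⟨r.pos, ?_, (key.trans h2.le)⟩, ?_, key.trans_lt h2⟩
  · exact Int.isCoprime_iff_nat_coprime.2 (by simpa using r.reduced)
  · refine key.trans_lt (lt_of_le_of_lt ?_ hn)
    apply one_div_le_one_div_of_le (by positivity); linarith

/-- A good approximation from below is accompanied by a better one from above. -/
theorem IsGoodApprox.exists_neg {α : ℝ} (hα : Irrational α) {q : ℕ} {p : ℤ}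
    (h : IsGoodApprox α q p) (hpos : 0 < q * α - p) (hlt : q * α - p < 1 / q) :
    ∃ q' : ℕ, ∃ p' : ℤ, IsGoodApprox α q' p' ∧ q' * α - p' < 0 ∧
      -(q' * α - p') < q * α - p := by
  obtain ⟨hq, hc, -⟩ := h
  set η := q * α - p with hη
  have hq' : (0 : ℝ) < q := by exact_mod_cast hq
  obtain ⟨u, v, huv⟩ := hc
  -- the candidates are `q' = -u + k q`, `p' = v + k p`
  set k : ℤ := ⌊(1 / η + u) / q⌋ with hk
  set Q : ℤ := -u + k * q with hQ
  set P : ℤ := v + k * p with hP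
  have hdet : p * Q - q * P = -1 := by rw [hQ, hP]; linear_combination -huv
  have hdetR : (p : ℝ) * Q - q * P = -1 := by exact_mod_cast hdet
  have hk1 : (k : ℝ) ≤ (1 / η + u) / q := Int.floor_le _
  have hk2 : (1 / η + u) / q < k + 1 := Int.lt_floor_add_one _
  rw [le_div_iff₀ hq'] at hk1
  rw [div_lt_iff₀ hq'] at hk2
  have hQR : (Q : ℝ) = -u + k * q := by rw [hQ]; push_cast; ring
  have hQ1 : (Q : ℝ) ≤ 1 / η := by linarith
  have hQ2 : 1 / η - q < (Q : ℝ) := by linarith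
  have hqη : (q : ℝ) < 1 / η := by
    rw [lt_div_iff₀ hpos]; rw [lt_div_iff₀ hq'] at hlt; linarith
  have hQposR : (0 : ℝ) < Q := by linarith
  have hQpos : 0 < Q := by exact_mod_cast hQposR
  have hmul : q * (Q * α - P) = -1 + Q * η := by rw [hη]; linear_combination hdetR
  have hQη : Q * η ≤ 1 := by rwa [le_div_iff₀ hpos] at hQ1
  have hQη2 : 1 - q * η < Q * η := by
    have := mul_lt_mul_of_pos_right hQ2 hpos
    rwa [sub_mul, one_div, inv_mul_cancel₀ hpos.ne'] at this
  have hne : (Q : ℝ) * α - P ≠ 0 := by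
    intro h0
    have : α = ((P / Q : ℚ) : ℝ) := by
      push_cast; field_simp; linarith
    exact hα ⟨_, this.symm⟩
  have hnonpos : (Q : ℝ) * α - P ≤ 0 := by
    by_contra hcon
    push Not at hcon
    have := mul_pos hq' hcon
    linarith
  have hneg : (Q : ℝ) * α - P < 0 := lt_of_le_of_ne hnonpos hne
  have hsmall : -((Q : ℝ) * α - P) < η := by
    refine lt_of_mul_lt_mul_left ?_ hq'.le
    linarith
  have hcast : ((Q.toNat : ℕ) : ℤ) = Q := Int.toNat_of_nonneg hQpos.le
  have hcastR : ((Q.toNat : ℕ) : ℝ) = Q := by exact_mod_cast congrArg (Int.cast : ℤ → ℝ) hcast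
  refine ⟨Q.toNat, P, ⟨by omega, ?_, ?_⟩, ?_, ?_⟩
  · rw [hcast]; exact ⟨q, -p, by linear_combination -hdet⟩
  · rw [hcastR, abs_of_neg hneg, le_div_iff₀ hQposR]
    nlinarith
  · rwa [hcastR]
  · rwa [hcastR]

/-- An irrational number has arbitrarily good approximations from both sides. -/
theorem exists_isGoodApprox_pos_neg {α : ℝ} (hα : Irrational α) {ε : ℝ} (hε : 0 < ε) :
    (∃ q : ℕ, ∃ p : ℤ, IsGoodApprox α q p ∧ 0 < q * α - p ∧ q * α - p < ε) ∧
    (∃ q : ℕ, ∃ p : ℤ, IsGoodApprox α q p ∧ q * α - p < 0 ∧ -ε < q * α - p) := by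
  obtain ⟨q, p, hg, h1, h2⟩ := exists_isGoodApprox (α := α) hε
  have hq : (0 : ℝ) < q := by exact_mod_cast hg.1
  have hne : (q : ℝ) * α - p ≠ 0 := by
    intro h0
    have : α = ((p / q : ℚ) : ℝ) := by
      push_cast; field_simp; linarith
    exact hα ⟨_, this.symm⟩
  rcases lt_or_gt_of_ne hne with hneg | hpos
  · rw [abs_of_neg hneg] at h1 h2
    have hflip : (q : ℝ) * -α - ((-p : ℤ) : ℝ) = -(q * α - p) := by push_cast; ring
    obtain ⟨q', p', hg', h3, h4⟩ := hg.neg.exists_neg hα.neg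
      (by rw [hflip]; linarith) (by rw [hflip]; exact h2)
    rw [hflip] at h4
    refine ⟨⟨q', -p', by simpa using hg'.neg, ?_, ?_⟩, q, p, hg, hneg, by linarith⟩
    · push_cast; linarith
    · push_cast; linarith
  · rw [abs_of_pos hpos] at h1 h2
    obtain ⟨q', p', hg', h3, h4⟩ := hg.exists_neg hα hpos h2
    exact ⟨⟨q, p, hg, hpos, h1⟩, q', p', hg', h3, by linarith⟩

/-- The residues `(m - j p) mod q`, `0 ≤ j < q`, are a permutation of `0, …, q - 1`. -/
theorem sum_emod_of_isCoprime {q : ℕ} {p : ℤ} (hq : 0 < q) (h : IsCoprime p (q : ℤ)) (m : ℤ) :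
    ∑ j ∈ Finset.range q, (((m - j * p) % q : ℤ) : ℝ) = q * (q - 1) / 2 := by
  have hq0 : (q : ℤ) ≠ 0 := by exact_mod_cast hq.ne'
  have hinj : Set.InjOn (fun j : ℕ => ((m - j * p) % q : ℤ).toNat) (Finset.range q : Set ℕ) := by
    intro i hi j hj hij
    have hi' : i < q := by simpa using hi
    have hj' : j < q := by simpa using hj
    have e1 := Int.emod_nonneg (m - i * p) hq0
    have e2 := Int.emod_nonneg (m - j * p) hq0
    have e3 : (m - i * p) % q = (m - j * p) % q := by
      have : ((m - i * p) % q : ℤ).toNat = ((m - j * p) % q : ℤ).toNat := hij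
      omega
    have e4 : (q : ℤ) ∣ (j - i) * p := by
      have := Int.ModEq.dvd (Int.ModEq.symm e3)
      have h5 : m - i * p - (m - j * p) = (j - i) * p := by ring
      rwa [h5] at this
    have e5 : (q : ℤ) ∣ (j - i) := h.symm.dvd_of_dvd_mul_right e4
    have e6 : (j : ℤ) - i = 0 := by
      apply Int.eq_zero_of_abs_lt_dvd e5
      rw [abs_lt]; constructor <;> omega
    omega
  have himg : (Finset.range q).image (fun j : ℕ => ((m - j * p) % q : ℤ).toNat)
      = Finset.range q := by
    apply Finset.eq_of_subset_of_card_le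
    · intro i hi
      obtain ⟨j, -, rfl⟩ := Finset.mem_image.1 hi
      have := Int.emod_lt_of_pos (m - j * p) (by exact_mod_cast hq : (0 : ℤ) < q)
      have := Int.emod_nonneg (m - j * p) hq0
      rw [Finset.mem_range]; omega
    · rw [Finset.card_image_of_injOn hinj]
  calc ∑ j ∈ Finset.range q, (((m - j * p) % q : ℤ) : ℝ)
      = ∑ j ∈ Finset.range q, ((((m - j * p) % q : ℤ).toNat : ℕ) : ℝ) := by
        refine Finset.sum_congr rfl fun j _ => ?_
        exact_mod_cast congrArg (Int.cast : ℤ → ℝ)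
          (Int.toNat_of_nonneg (Int.emod_nonneg (m - j * p) hq0)).symm
    _ = ∑ i ∈ (Finset.range q).image (fun j : ℕ => ((m - j * p) % q : ℤ).toNat), (i : ℝ) := by
        rw [Finset.sum_image hinj]
    _ = q * (q - 1) / 2 := by
        rw [himg]
        clear hinj himg h hq hq0
        induction q with
        | zero => simp
        | succ n ih => rw [Finset.sum_range_succ, ih]; push_cast; ring

theorem sum_fract_sub_mul_div {q : ℕ} {p : ℤ} (hq : 0 < q) (h : IsCoprime p (q : ℤ)) (u : ℝ) :
    ∑ j ∈ Finset.range q, Int.fract (u - j * p / q) = Int.fract (q * u) + (q - 1) / 2 := by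
  have hq' : (0 : ℝ) < q := by exact_mod_cast hq
  have hqz : (0 : ℤ) < q := by exact_mod_cast hq
  have hterm : ∀ j : ℕ, Int.fract (u - j * p / q)
      = (((⌊q * u⌋ - j * p) % q : ℤ) : ℝ) / q + Int.fract (q * u) / q := by
    intro j
    rw [Int.fract_eq_iff]
    have e0 := Int.emod_nonneg (⌊q * u⌋ - j * p) hqz.ne'
    have e1 := Int.emod_lt_of_pos (⌊q * u⌋ - j * p) hqz
    have f0 := Int.fract_nonneg (q * u)
    have f1 := Int.fract_lt_one (q * u)
    have e0' : (0 : ℝ) ≤ (((⌊q * u⌋ - j * p) % q : ℤ) : ℝ) := by exact_mod_cast e0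
    have e1' : (((⌊q * u⌋ - j * p) % q : ℤ) : ℝ) + 1 ≤ q := by exact_mod_cast e1
    refine ⟨by positivity, ?_, (⌊q * u⌋ - j * p) / q, ?_⟩
    · rw [← add_div, div_lt_one hq']; linarith
    · have e2 : (((⌊q * u⌋ - j * p) % q : ℤ) : ℝ)
          + q * (((⌊q * u⌋ - j * p) / q : ℤ) : ℝ) = ⌊q * u⌋ - j * p := by
        exact_mod_cast congrArg (Int.cast : ℤ → ℝ) (Int.emod_add_mul_ediv (⌊q * u⌋ - j * p) q)
      have e3 := Int.floor_add_fract (q * u)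
      generalize ⌊q * u⌋ = M at e2 e3 ⊢
      generalize Int.fract (q * u) = r at e3 ⊢
      field_simp
      linarith
  simp_rw [hterm]
  rw [Finset.sum_add_distrib, ← Finset.sum_div, sum_emod_of_isCoprime hq h]
  simp
  field_simp
  ring

theorem Int.fract_le_fract_sub_add (v : ℝ) {t : ℝ} (ht : 0 ≤ t) :
    Int.fract v ≤ Int.fract (v - t) + t := by
  have : (⌊v - t⌋ : ℝ) ≤ ⌊v⌋ := by exact_mod_cast Int.floor_mono (by linarith)
  unfold Int.fract
  linarith

/-- The Denjoy–Koksma inequality for the sawtooth function. -/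
theorem IsGoodApprox.abs_sum_fract_sub_le {α : ℝ} {q : ℕ} {p : ℤ} (h : IsGoodApprox α q p)
    (u : ℝ) : |∑ j ∈ Finset.range q, (Int.fract (u - j * α) - 1 / 2)| ≤ 3 := by
  obtain ⟨hq, hc, hb⟩ := h
  have hq' : (0 : ℝ) < q := by exact_mod_cast hq
  have hθ : ∀ j ∈ Finset.range q, |(j * α - j * p / q : ℝ)| ≤ 1 / q := by
    intro j hj
    have hj' : (j : ℝ) ≤ q := by exact_mod_cast (Finset.mem_range.1 hj).le
    have : (j * α - j * p / q : ℝ) = (j / q) * (q * α - p) := by field_simp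
    rw [this, abs_mul, abs_of_nonneg (by positivity)]
    calc (j / q : ℝ) * |q * α - p| ≤ 1 * (1 / q) := by
          gcongr
          rwa [div_le_one hq']
      _ = 1 / q := one_mul _
  have upper : ∑ j ∈ Finset.range q, Int.fract (u - j * α) ≤
      ∑ j ∈ Finset.range q, (Int.fract ((u - 1 / q) - j * p / q) + 2 / q) := by
    refine Finset.sum_le_sum fun j hj => ?_
    have hj := abs_le.1 (hθ j hj)
    have := Int.fract_le_fract_sub_add (u - j * α) (t := 1 / q - (j * α - j * p / q))
      (by linarith)
    have e : u - j * α - (1 / q - (j * α - j * p / q)) = (u - 1 / q) - j * p / q := by ring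
    rw [e] at this
    have : (2 / q : ℝ) = 1 / q + 1 / q := by ring
    linarith
  have lower : ∑ j ∈ Finset.range q, (Int.fract ((u + 1 / q) - j * p / q) - 2 / q) ≤
      ∑ j ∈ Finset.range q, Int.fract (u - j * α) := by
    refine Finset.sum_le_sum fun j hj => ?_
    have hj := abs_le.1 (hθ j hj)
    have := Int.fract_le_fract_sub_add ((u + 1 / q) - j * p / q)
      (t := 1 / q + (j * α - j * p / q)) (by linarith)
    have e : (u + 1 / q) - j * p / q - (1 / q + (j * α - j * p / q)) = u - j * α := by ring
    rw [e] at this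
    have : (2 / q : ℝ) = 1 / q + 1 / q := by ring
    linarith
  rw [Finset.sum_add_distrib, sum_fract_sub_mul_div hq hc] at upper
  rw [Finset.sum_sub_distrib, sum_fract_sub_mul_div hq hc] at lower
  have hc2 : ∑ _j ∈ Finset.range q, (2 / q : ℝ) = 2 := by simp; field_simp
  rw [hc2] at upper lower
  have a1 := Int.fract_lt_one (q * (u - 1 / q))
  have a2 := Int.fract_nonneg (q * (u + 1 / q))
  rw [Finset.sum_sub_distrib]
  simp only [Finset.sum_const, Finset.card_range, nsmul_eq_mul]
  rw [abs_le]
  constructor <;> linarith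

/-- The sawtooth function `t ↦ {t} - 1/2` on the circle. -/
def sawtooth (s : AddCircle (1 : ℝ)) : ℝ := (AddCircle.equivIco 1 0 s : ℝ) - 1 / 2

theorem sawtooth_coe (t : ℝ) : sawtooth (t : AddCircle (1 : ℝ)) = Int.fract t - 1 / 2 := by
  have := AddCircle.coe_equivIco_mk_apply (p := (1 : ℝ)) t
  simp only [div_one, mul_one] at this
  rw [sawtooth]
  exact congrArg (· - 1 / 2) this

theorem measurable_sawtooth : Measurable sawtooth :=
  (measurable_subtype_coe.comp (AddCircle.measurableEquivIco 1 0).measurable).sub_const _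

theorem abs_sawtooth_le (s : AddCircle (1 : ℝ)) : |sawtooth s| ≤ 1 := by
  induction s using QuotientAddGroup.induction_on with
  | H t =>
    rw [show sawtooth (QuotientAddGroup.mk t) = _ from sawtooth_coe t, abs_le]
    constructor <;> linarith [Int.fract_nonneg t, Int.fract_lt_one t]

theorem integral_sawtooth : ∫ s : AddCircle (1 : ℝ), sawtooth s = 0 := by
  rw [← AddCircle.intervalIntegral_preimage 1 0]
  have : ∫ t in (0 : ℝ)..0 + 1, sawtooth (t : AddCircle (1 : ℝ))
      = ∫ t in (0 : ℝ)..0 + 1, (t - 1 / 2) := by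
    refine intervalIntegral.integral_congr_ae ?_
    have h1 : ∀ᵐ t : ℝ, t ≠ 1 := by simp [ae_iff, measure_singleton]
    filter_upwards [h1] with t ht hmem
    rw [Set.uIoc_of_le (by norm_num)] at hmem
    rw [sawtooth_coe, Int.fract_eq_self.2 ⟨hmem.1.le, lt_of_le_of_ne (by linarith [hmem.2]) ht⟩]
  rw [this]
  simp

/-- The Birkhoff sum of the sawtooth function over the backward rotation. -/
def sawtoothSum (α : ℝ) (q : ℕ) (s : AddCircle (1 : ℝ)) : ℝ :=
  ∑ j ∈ Finset.range q, sawtooth (s - ((j * α : ℝ) : AddCircle (1 : ℝ)))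

theorem measurable_sawtoothSum (α : ℝ) (q : ℕ) : Measurable (sawtoothSum α q) :=
  Finset.measurable_fun_sum _ fun _ _ => measurable_sawtooth.comp (measurable_id.sub_const _)

theorem IsGoodApprox.abs_sawtoothSum_le {α : ℝ} {q : ℕ} {p : ℤ} (h : IsGoodApprox α q p)
    (s : AddCircle (1 : ℝ)) : |sawtoothSum α q s| ≤ 3 := by
  induction s using QuotientAddGroup.induction_on with
  | H t =>
    have e : sawtoothSum α q (QuotientAddGroup.mk t)
        = ∑ j ∈ Finset.range q, (Int.fract (t - j * α) - 1 / 2) := by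
      refine Finset.sum_congr rfl fun j _ => ?_
      rw [← sawtooth_coe, AddCircle.coe_sub]
    rw [e]
    exact h.abs_sum_fract_sub_le t

theorem integrable_mul_comp_sub {f : AddCircle (1 : ℝ) → ℂ} (hf : Integrable f)
    {k : AddCircle (1 : ℝ) → ℝ} (hk : Measurable k) {C : ℝ} (hC : ∀ s, |k s| ≤ C)
    (x : AddCircle (1 : ℝ)) : Integrable fun s => f s * (k (s - x) : ℂ) := by
  refine hf.mul_bdd (c := C) ?_ (ae_of_all _ fun s => ?_)
  · exact (Complex.measurable_ofReal.comp
      (hk.comp (measurable_id.sub_const x))).aestronglyMeasurable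
  · simpa using hC (s - x)

/-- The convolution of `f` with `sawtoothSum α q` is uniformly small as soon as `q` is a good
denominator and `q α` is close to an integer. -/
def SawtoothDecay (α : ℝ) (f : AddCircle (1 : ℝ) → ℂ) : Prop :=
  ∀ δ > 0, ∃ ε > 0, ∀ (q : ℕ) (p : ℤ), IsGoodApprox α q p → |q * α - p| < ε →
    ∀ x, ‖∫ s, f s * (sawtoothSum α q (s - x) : ℂ)‖ ≤ δ

theorem SawtoothDecay.add {α : ℝ} {f g : AddCircle (1 : ℝ) → ℂ} (hf : Integrable f)
    (hg : Integrable g) (hfd : SawtoothDecay α f) (hgd : SawtoothDecay α g) :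
    SawtoothDecay α (fun s => f s + g s) := by
  intro δ hδ
  obtain ⟨ε₁, hε₁, h₁⟩ := hfd (δ / 2) (by positivity)
  obtain ⟨ε₂, hε₂, h₂⟩ := hgd (δ / 2) (by positivity)
  refine ⟨min ε₁ ε₂, lt_min hε₁ hε₂, fun q p hg' hlt x => ?_⟩
  have m := measurable_sawtoothSum α q
  have b := hg'.abs_sawtoothSum_le
  simp_rw [add_mul]
  rw [integral_add (integrable_mul_comp_sub hf m b x) (integrable_mul_comp_sub hg m b x)]
  refine (norm_add_le _ _).trans ?_
  have := h₁ q p hg' (hlt.trans_le (min_le_left _ _)) x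
  have := h₂ q p hg' (hlt.trans_le (min_le_right _ _)) x
  linarith

theorem SawtoothDecay.const_mul {α : ℝ} {f : AddCircle (1 : ℝ) → ℂ} (c : ℂ)
    (hfd : SawtoothDecay α f) : SawtoothDecay α (fun s => c * f s) := by
  intro δ hδ
  obtain ⟨ε, hε, h⟩ := hfd (δ / (‖c‖ + 1)) (by positivity)
  refine ⟨ε, hε, fun q p hg hlt x => ?_⟩
  simp_rw [mul_assoc]
  rw [integral_const_mul, norm_mul]
  have h1 := h q p hg hlt x
  calc ‖c‖ * _ ≤ (‖c‖ + 1) * (δ / (‖c‖ + 1)) := by gcongr; linarith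
    _ = δ := by field_simp

theorem SawtoothDecay.of_approx {α : ℝ} {f : AddCircle (1 : ℝ) → ℂ} (hf : Integrable f)
    (h : ∀ δ > 0, ∃ g, Integrable g ∧ SawtoothDecay α g ∧ ∫ s, ‖f s - g s‖ ≤ δ) :
    SawtoothDecay α f := by
  intro δ hδ
  obtain ⟨g, hg, hgd, hfg⟩ := h (δ / 6) (by positivity)
  obtain ⟨ε, hε, h'⟩ := hgd (δ / 2) (by positivity)
  refine ⟨ε, hε, fun q p hq hlt x => ?_⟩
  have m := measurable_sawtoothSum α q
  have b := hq.abs_sawtoothSum_le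
  have e : ∫ s, f s * (sawtoothSum α q (s - x) : ℂ)
      = (∫ s, (f s - g s) * (sawtoothSum α q (s - x) : ℂ))
        + ∫ s, g s * (sawtoothSum α q (s - x) : ℂ) := by
    refine Eq.trans (integral_congr_ae (ae_of_all _ fun s => ?_)) (integral_add
      (integrable_mul_comp_sub (hf.sub hg) m b x) (integrable_mul_comp_sub hg m b x))
    ring
  have h1 : ‖∫ s, (f s - g s) * (sawtoothSum α q (s - x) : ℂ)‖ ≤ δ / 2 := by
    calc _ ≤ ∫ s, ‖(f s - g s) * (sawtoothSum α q (s - x) : ℂ)‖ :=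
          norm_integral_le_integral_norm _
      _ ≤ ∫ s, ‖f s - g s‖ * 3 := by
          refine integral_mono (integrable_mul_comp_sub (hf.sub hg) m b x).norm
            ((hf.sub hg).norm.mul_const 3) fun s => ?_
          simp only [norm_mul, Complex.norm_real, Real.norm_eq_abs]
          gcongr
          exact b _
      _ = (∫ s, ‖f s - g s‖) * 3 := integral_mul_const _ _
      _ ≤ δ / 2 := by linarith
  rw [e]
  refine (norm_add_le _ _).trans ?_
  linarith [h' q p hq hlt x]

theorem fourier_apply_add (n : ℤ) (s t : AddCircle (1 : ℝ)) :
    fourier n (s + t) = fourier n s * fourier n t := by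
  simp [fourier_apply, smul_add, AddCircle.toCircle_add]

theorem fourier_coe_ne_one {α : ℝ} (hα : Irrational α) {n : ℤ} (hn : n ≠ 0) :
    fourier n (α : AddCircle (1 : ℝ)) ≠ 1 := by
  intro h
  rw [fourier_apply] at h
  have h1 : AddCircle.toCircle (n • (α : AddCircle (1 : ℝ))) = 1 := Circle.ext h
  rw [← AddCircle.toCircle_zero (T := (1 : ℝ))] at h1
  have h2 := AddCircle.injective_toCircle one_ne_zero h1
  rw [← AddCircle.coe_zsmul, AddCircle.coe_eq_zero_iff] at h2
  obtain ⟨m, hm⟩ := h2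
  simp only [zsmul_eq_mul, mul_one] at hm
  have hn' : (n : ℝ) ≠ 0 := by exact_mod_cast hn
  exact hα ⟨m / n, by push_cast; field_simp; linarith⟩

theorem fourier_coe_natCast_mul (n : ℤ) (j : ℕ) (α : ℝ) :
    fourier n ((j * α : ℝ) : AddCircle (1 : ℝ)) = (fourier n (α : AddCircle (1 : ℝ))) ^ j := by
  induction j with
  | zero => simp [fourier_apply]
  | succ j ih =>
    rw [pow_succ, ← ih, ← fourier_apply_add, ← AddCircle.coe_add]
    congr 2
    push_cast; ring

theorem integral_fourier_mul_sawtoothSum (α : ℝ) (n : ℤ) (q : ℕ) (x : AddCircle (1 : ℝ)) :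
    ∫ s, fourier n s * (sawtoothSum α q (s - x) : ℂ) = fourier n x *
      (∑ j ∈ Finset.range q, (fourier n (α : AddCircle (1 : ℝ))) ^ j) *
        ∫ s, fourier n s * (sawtooth s : ℂ) := by
  have hint : Integrable fun s : AddCircle (1 : ℝ) => fourier n s :=
    (fourier n).continuous.integrable_of_hasCompactSupport (.of_compactSpace _)
  have e1 : ∀ s, fourier n s * (sawtoothSum α q (s - x) : ℂ) = ∑ j ∈ Finset.range q,
      fourier n s * (sawtooth (s - (x + ((j * α : ℝ) : AddCircle (1 : ℝ)))) : ℂ) := by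
    intro s
    rw [sawtoothSum]
    push_cast
    rw [Finset.mul_sum]
    simp only [sub_sub]
  simp_rw [e1]
  rw [integral_finsetSum _ fun j _ =>
    integrable_mul_comp_sub hint measurable_sawtooth abs_sawtooth_le _]
  rw [Finset.mul_sum, Finset.sum_mul]
  refine Finset.sum_congr rfl fun j _ => ?_
  rw [← fourier_coe_natCast_mul, ← fourier_apply_add, ← integral_const_mul]
  rw [← integral_add_right_eq_self _ (x + ((j * α : ℝ) : AddCircle (1 : ℝ)))]
  refine integral_congr_ae (ae_of_all _ fun s => ?_)
  simp only [add_sub_cancel_right, fourier_apply_add]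
  ring

theorem sawtoothDecay_fourier {α : ℝ} (hα : Irrational α) (n : ℤ) :
    SawtoothDecay α (fun s => fourier n s) := by
  intro δ hδ
  rcases eq_or_ne n 0 with rfl | hn
  · refine ⟨1, one_pos, fun q p _ _ x => ?_⟩
    rw [integral_fourier_mul_sawtoothSum]
    have : ∫ s : AddCircle (1 : ℝ), fourier 0 s * (sawtooth s : ℂ) = 0 := by
      simp only [fourier_zero, one_mul]
      rw [integral_complex_ofReal, integral_sawtooth, Complex.ofReal_zero]
    rw [this, mul_zero, norm_zero]
    exact hδ.le
  set w : ℂ := fourier n (α : AddCircle (1 : ℝ)) with hw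
  have hw1 : w - 1 ≠ 0 := sub_ne_zero.2 (fourier_coe_ne_one hα hn)
  set c : ℂ := ∫ s : AddCircle (1 : ℝ), fourier n s * (sawtooth s : ℂ) with hc
  have hcont : Continuous fun t : ℝ => (fourier n (t : AddCircle (1 : ℝ)) : ℂ) :=
    (fourier n).continuous.comp (AddCircle.continuous_mk' 1)
  obtain ⟨ε, hε, hε'⟩ := Metric.continuousAt_iff.1 (hcont.continuousAt (x := 0))
    (δ * ‖w - 1‖ / (‖c‖ + 1)) (by have := norm_pos_iff.2 hw1; positivity)
  refine ⟨ε, hε, fun q p _ hlt x => ?_⟩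
  rw [integral_fourier_mul_sawtoothSum, ← hw, ← hc, geom_sum_eq (sub_ne_zero.1 hw1), norm_mul,
    norm_mul, norm_div]
  have hx : ‖(fourier n x : ℂ)‖ = 1 := Circle.norm_coe _
  have hq : w ^ q = fourier n ((q * α - p : ℝ) : AddCircle (1 : ℝ)) := by
    rw [hw, ← fourier_coe_natCast_mul]
    congr 1
    have : ((p : ℝ) : AddCircle (1 : ℝ)) = 0 :=
      (AddCircle.coe_eq_zero_iff 1).2 ⟨p, by simp⟩
    rw [AddCircle.coe_sub, this, sub_zero]
  have h1 : ‖w ^ q - 1‖ ≤ δ * ‖w - 1‖ / (‖c‖ + 1) := by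
    have := hε' (x := q * α - p) (by simpa [Real.dist_eq] using hlt)
    rw [dist_eq_norm] at this
    have h0 : (fourier n ((0 : ℝ) : AddCircle (1 : ℝ)) : ℂ) = 1 := by simp [fourier_apply]
    rw [h0, ← hq] at this
    exact this.le
  rw [hx, one_mul]
  have hpos := norm_pos_iff.2 hw1
  calc ‖w ^ q - 1‖ / ‖w - 1‖ * ‖c‖ ≤ (δ * ‖w - 1‖ / (‖c‖ + 1)) / ‖w - 1‖ * (‖c‖ + 1) := by
        gcongr; linarith
    _ = δ := by field_simp

theorem integrable_continuousMap (f : C(AddCircle (1 : ℝ), ℂ)) :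
    Integrable (fun s => f s) :=
  f.continuous.integrable_of_hasCompactSupport (.of_compactSpace _)

theorem sawtoothDecay_of_integrable {α : ℝ} (hα : Irrational α) {f : AddCircle (1 : ℝ) → ℂ}
    (hf : Integrable f) : SawtoothDecay α f := by
  have hspan : ∀ g ∈ Submodule.span ℂ (Set.range (@fourier (1 : ℝ))),
      SawtoothDecay α (fun s => g s) := by
    intro g hg
    induction hg using Submodule.span_induction with
    | mem g hg =>
      obtain ⟨n, rfl⟩ := hg
      exact sawtoothDecay_fourier hα n
    | zero =>
      intro δ hδ
      exact ⟨1, one_pos, fun q p _ _ x => by simpa using hδ.le⟩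
    | add g k _ _ hg hk =>
      exact hg.add (integrable_continuousMap g) (integrable_continuousMap k) hk
    | smul c g _ hg => exact hg.const_mul c
  have hcont : ∀ g : C(AddCircle (1 : ℝ), ℂ), SawtoothDecay α (fun s => g s) := by
    intro g
    refine .of_approx (integrable_continuousMap g) fun δ hδ => ?_
    have hg : g ∈ closure (Submodule.span ℂ (Set.range (@fourier (1 : ℝ))) :
        Set C(AddCircle (1 : ℝ), ℂ)) := by
      rw [← Submodule.topologicalClosure_coe, span_fourier_closure_eq_top]
      trivial
    obtain ⟨k, hk, hgk⟩ := Metric.mem_closure_iff.1 hg δ hδ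
    refine ⟨fun s => k s, integrable_continuousMap k, hspan k hk, ?_⟩
    calc ∫ s, ‖g s - k s‖ ≤ ∫ _s : AddCircle (1 : ℝ), δ := by
          refine integral_mono ((integrable_continuousMap g).sub
            (integrable_continuousMap k)).norm (integrable_const _) fun s => ?_
          have := ContinuousMap.dist_apply_le_dist (f := g) (g := k) s
          rw [dist_eq_norm] at this
          exact this.trans hgk.le
      _ = δ := by simp [Measure.real]
  refine .of_approx hf fun δ hδ => ?_
  obtain ⟨g, hg, hgi⟩ := hf.exists_boundedContinuous_integral_sub_le hδ
  exact ⟨g, hgi, hcont g.toContinuousMap, hg⟩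

theorem integral_integral_mul_sawtooth {f : AddCircle (1 : ℝ) → ℂ} (hf : Integrable f) :
    ∫ y, ∫ s, f s * (sawtooth (s - y) : ℂ) = 0 := by
  rw [integral_integral_swap]
  · have : ∀ s : AddCircle (1 : ℝ), ∫ y, f s * (sawtooth (s - y) : ℂ) = 0 := by
      intro s
      rw [integral_const_mul, integral_complex_ofReal,
        integral_sub_left_eq_self (fun y => sawtooth y), integral_sawtooth]
      simp
    simp [this]
  · refine (hf.comp_snd volume).mul_bdd (c := 1) ?_ (ae_of_all _ fun z => ?_)
    · exact (Complex.measurable_ofReal.comp (measurable_sawtooth.comp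
        (measurable_snd.sub measurable_fst))).aestronglyMeasurable
    · simpa using abs_sawtooth_le _

theorem intervalIntegral_mul_fract {g : ℝ → ℝ} (hg : IntervalIntegrable g volume 0 1)
    {y : ℝ} (hy : y ∈ Set.Ico (0 : ℝ) 1) :
    ∫ t in (0 : ℝ)..1, g t * (Int.fract (t - y) - 1 / 2)
      = (∫ t in (0 : ℝ)..1, g t * (t - y - 1 / 2)) + ∫ t in (0 : ℝ)..y, g t := by
  have hyu : y ∈ Set.uIcc (0 : ℝ) 1 := by
    rw [Set.uIcc_of_le zero_le_one]; exact ⟨hy.1, hy.2.le⟩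
  have hg0 : IntervalIntegrable g volume 0 y := hg.mono_set (Set.uIcc_subset_uIcc_left hyu)
  have hlin : IntervalIntegrable (fun t => g t * (t - y - 1 / 2)) volume 0 1 :=
    hg.mul_continuousOn (by fun_prop)
  have hfr : IntervalIntegrable (fun t => g t * (Int.fract (t - y) - 1 / 2)) volume 0 1 := by
    rw [intervalIntegrable_iff] at hg ⊢
    refine hg.mul_bdd (c := 1) ?_ (ae_of_all _ fun t => ?_)
    · exact ((measurable_fract.comp (measurable_id.sub_const y)).sub_const _).aestronglyMeasurable
    · rw [Real.norm_eq_abs, abs_le]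
      constructor <;> linarith [Int.fract_nonneg (t - y), Int.fract_lt_one (t - y)]
  have ae_ne : ∀ c : ℝ, ∀ᵐ t : ℝ, t ≠ c := fun c => by simp [ae_iff, measure_singleton]
  have h1 : ∫ t in (0 : ℝ)..y, g t * (Int.fract (t - y) - 1 / 2)
      = ∫ t in (0 : ℝ)..y, (g t * (t - y - 1 / 2) + g t) := by
    refine intervalIntegral.integral_congr_ae ?_
    filter_upwards [ae_ne y] with t ht hmem
    rw [Set.uIoc_of_le hy.1] at hmem
    have hlt : t < y := lt_of_le_of_ne hmem.2 ht
    have : Int.fract (t - y) = t - y + 1 := by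
      rw [Int.fract_eq_iff]
      exact ⟨by linarith [hmem.1, hy.2], by linarith, -1, by push_cast; ring⟩
    rw [this]; ring
  have h2 : ∫ t in y..1, g t * (Int.fract (t - y) - 1 / 2)
      = ∫ t in y..1, g t * (t - y - 1 / 2) := by
    refine intervalIntegral.integral_congr_ae ?_
    filter_upwards [ae_ne 1] with t ht hmem
    rw [Set.uIoc_of_le hy.2.le] at hmem
    have hlt : t < 1 := lt_of_le_of_ne hmem.2 ht
    rw [Int.fract_eq_self.2 ⟨by linarith [hmem.1], by linarith [hy.1]⟩]
  rw [← intervalIntegral.integral_add_adjacent_intervals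
    (hfr.mono_set (Set.uIcc_subset_uIcc_left hyu)) (hfr.mono_set (Set.uIcc_subset_uIcc_right hyu)),
    ← intervalIntegral.integral_add_adjacent_intervals
    (hlin.mono_set (Set.uIcc_subset_uIcc_left hyu))
    (hlin.mono_set (Set.uIcc_subset_uIcc_right hyu)), h1, h2,
    intervalIntegral.integral_add (hlin.mono_set (Set.uIcc_subset_uIcc_left hyu)) hg0]
  ring

/-- An absolutely continuous function of zero mean is the convolution of its derivative with the
sawtooth function. -/
theorem AbsolutelyContinuous'.exists_eq_integral_mul_sawtooth {φ : AddCircle (1 : ℝ) → ℝ}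
    (h : AbsolutelyContinuous' φ) (hφ : Continuous φ) (h0 : ∫ x, φ x = 0) :
    ∃ f : AddCircle (1 : ℝ) → ℂ, Integrable f ∧
      ∀ y, (φ y : ℂ) = ∫ s, f s * (sawtooth (s - y) : ℂ) := by
  obtain ⟨g, hg, hφg⟩ := h
  have hgi : IntervalIntegrable g volume 0 1 := by
    rw [intervalIntegrable_iff_integrableOn_Icc_of_le zero_le_one]; exact hg
  set f : AddCircle (1 : ℝ) → ℂ := AddCircle.liftIoc 1 0 fun t => (g t : ℂ) with hf
  have hfi : Integrable f := by
    rw [← memLp_one_iff_integrable]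
    apply MemLp.memLp_liftIoc
    rw [memLp_one_iff_integrable, zero_add]
    exact (hg.mono_set Set.Ioc_subset_Icc_self).ofReal
  have hg1 : ∫ t in (0 : ℝ)..1, g t = 0 := by
    rw [← hφg 1 ⟨zero_le_one, le_rfl⟩, AddCircle.coe_period, AddCircle.coe_zero, sub_self]
  obtain ⟨c, hc⟩ : ∃ c : ℝ, ∀ y, ∫ s, f s * (sawtooth (s - y) : ℂ) = φ y + c := by
    refine ⟨(∫ t in (0 : ℝ)..1, g t * t) - φ ((0 : ℝ) : AddCircle (1 : ℝ)), fun y => ?_⟩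
    obtain ⟨y, hy, rfl⟩ : ∃ t ∈ Set.Ico (0 : ℝ) 1, (t : AddCircle (1 : ℝ)) = y := by
      have := AddCircle.coe_image_Ico_eq (1 : ℝ) 0
      rw [zero_add] at this
      have hy : y ∈ ((↑) : ℝ → AddCircle (1 : ℝ)) '' Set.Ico 0 1 := this ▸ Set.mem_univ y
      exact hy
    have e1 : ∫ s, f s * (sawtooth (s - y) : ℂ)
        = ((∫ t in (0 : ℝ)..1, g t * (Int.fract (t - y) - 1 / 2) : ℝ) : ℂ) := by
      rw [← AddCircle.intervalIntegral_preimage 1 0, zero_add,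
        ← intervalIntegral.integral_ofReal]
      refine intervalIntegral.integral_congr_ae (ae_of_all _ fun t ht => ?_)
      rw [Set.uIoc_of_le zero_le_one] at ht
      rw [hf, AddCircle.liftIoc_coe_apply (by simpa using ht), ← AddCircle.coe_sub, sawtooth_coe]
      push_cast
      rfl
    have e2 : ∫ t in (0 : ℝ)..1, g t * (t - y - 1 / 2) = ∫ t in (0 : ℝ)..1, g t * t := by
      have : ∀ t, g t * (t - y - 1 / 2) = g t * t - g t * (y + 1 / 2) := fun t => by ring
      simp_rw [this]
      rw [intervalIntegral.integral_sub (hgi.mul_continuousOn (g := fun t => t) continuousOn_id)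
        (hgi.mul_const _), intervalIntegral.integral_mul_const, hg1]
      simp
    rw [e1, intervalIntegral_mul_fract hgi hy, e2, ← hφg y ⟨hy.1, hy.2.le⟩]
    push_cast
    ring
  have hc0 : (c : ℂ) = 0 := by
    have e := integral_integral_mul_sawtooth hfi
    simp_rw [hc] at e
    have hφi : Integrable fun y => (φ y : ℂ) :=
      (Complex.continuous_ofReal.comp hφ).integrable_of_hasCompactSupport (.of_compactSpace _)
    rw [integral_add hφi (integrable_const _), integral_complex_ofReal, h0] at e
    simpa [Measure.real, UnitAddCircle.measure_univ] using e
  refine ⟨f, hfi, fun y => ?_⟩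
  rw [hc, hc0, add_zero]

/-- Birkhoff sums of an absolutely continuous function of zero mean are uniformly small along
good denominators. -/
theorem AbsolutelyContinuous'.birkhoff_small {φ : AddCircle (1 : ℝ) → ℝ}
    (h : AbsolutelyContinuous' φ) (hφ : Continuous φ) (h0 : ∫ x, φ x = 0)
    {α : ℝ} (hα : Irrational α) {δ : ℝ} (hδ : 0 < δ) :
    ∃ ε > 0, ∀ (q : ℕ) (p : ℤ), IsGoodApprox α q p → |q * α - p| < ε →
      ∀ x, |∑ j ∈ Finset.range q, φ (x + ((j * α : ℝ) : AddCircle (1 : ℝ)))| ≤ δ := by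
  obtain ⟨f, hf, hφf⟩ := h.exists_eq_integral_mul_sawtooth hφ h0
  obtain ⟨ε, hε, hd⟩ := sawtoothDecay_of_integrable hα hf δ hδ
  refine ⟨ε, hε, fun q p hg hlt x => ?_⟩
  have e : ((∑ j ∈ Finset.range q, φ (x + ((j * α : ℝ) : AddCircle (1 : ℝ))) : ℝ) : ℂ)
      = ∫ s, f s * (sawtoothSum α q (s - x) : ℂ) := by
    push_cast
    simp_rw [hφf, sawtoothSum]
    push_cast
    simp_rw [Finset.mul_sum, sub_sub]
    rw [integral_finsetSum _ fun j _ =>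
      integrable_mul_comp_sub hf measurable_sawtooth abs_sawtooth_le _]
  have := hd q p hg hlt x
  rwa [← e, Complex.norm_real, Real.norm_eq_abs] at this

/-- The Birkhoff cocycle: the second coordinate of `F^n (x, 0)`. -/
def cocycle (α : ℝ) (φ : AddCircle (1 : ℝ) → ℝ) (n : ℤ) (x : AddCircle (1 : ℝ)) : ℝ :=
  (((anzai α φ) ^ n) (x, 0)).2

theorem anzai_zpow_apply (α : ℝ) (φ : AddCircle (1 : ℝ) → ℝ) (n : ℤ) :
    ∀ (x : AddCircle (1 : ℝ)) (t : ℝ), ((anzai α φ) ^ n) (x, t)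
      = (x + n • (α : AddCircle (1 : ℝ)), t + cocycle α φ n x) := by
  induction n using Int.induction_on with
  | zero => intro x t; simp [cocycle]
  | succ n ih =>
    intro x t
    have e : ∀ t, ((anzai α φ) ^ ((n : ℤ) + 1)) (x, t)
        = ((anzai α φ) ^ (n : ℤ)) (x + (α : AddCircle (1 : ℝ)), t + φ x) := fun t => by
      rw [zpow_add_one]; rfl
    rw [cocycle, e, e, ih, ih]
    ext
    · simp only [add_smul, one_smul]; abel
    · simp only; ring
  | pred n ih =>
    intro x t
    have e : ∀ t, ((anzai α φ) ^ (-(n : ℤ) - 1)) (x, t)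
        = ((anzai α φ) ^ (-(n : ℤ))) (x - (α : AddCircle (1 : ℝ)),
          t - φ (x - (α : AddCircle (1 : ℝ)))) := fun t => by
      rw [zpow_sub_one]; rfl
    rw [cocycle, e, e, ih, ih]
    ext
    · simp only [sub_smul, one_smul]; abel
    · simp only; ring

theorem cocycle_add (α : ℝ) (φ : AddCircle (1 : ℝ) → ℝ) (m n : ℤ) (x : AddCircle (1 : ℝ)) :
    cocycle α φ (m + n) x
      = cocycle α φ n x + cocycle α φ m (x + n • (α : AddCircle (1 : ℝ))) := by
  have : ((anzai α φ) ^ (m + n)) (x, 0) = ((anzai α φ) ^ m) (((anzai α φ) ^ n) (x, 0)) := by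
    rw [zpow_add]; rfl
  rw [cocycle, this, anzai_zpow_apply, anzai_zpow_apply]
  simp

theorem cocycle_zero (α : ℝ) (φ : AddCircle (1 : ℝ) → ℝ) (x : AddCircle (1 : ℝ)) :
    cocycle α φ 0 x = 0 := by simp [cocycle]

theorem cocycle_one (α : ℝ) (φ : AddCircle (1 : ℝ) → ℝ) (x : AddCircle (1 : ℝ)) :
    cocycle α φ 1 x = φ x := by simp [cocycle, anzai]

theorem cocycle_natCast (α : ℝ) (φ : AddCircle (1 : ℝ) → ℝ) (n : ℕ) (x : AddCircle (1 : ℝ)) :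
    cocycle α φ n x
      = ∑ j ∈ Finset.range n, φ (x + ((j * α : ℝ) : AddCircle (1 : ℝ))) := by
  induction n with
  | zero => simp [cocycle_zero]
  | succ n ih =>
    rw [Finset.sum_range_succ, ← ih, Nat.cast_succ, add_comm (n : ℤ) 1, cocycle_add, cocycle_one,
      ← AddCircle.coe_zsmul]
    simp

theorem continuous_cocycle (α : ℝ) {φ : AddCircle (1 : ℝ) → ℝ} (hφ : Continuous φ) (n : ℤ) :
    Continuous (cocycle α φ n) := by
  induction n using Int.induction_on with
  | zero => simpa [funext (cocycle_zero α φ)] using continuous_const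
  | succ n ih =>
    have e : cocycle α φ (n + 1)
        = fun x => φ x + cocycle α φ n (x + (α : AddCircle (1 : ℝ))) := by
      funext x
      rw [cocycle_add, cocycle_one, one_smul]
    rw [e]
    fun_prop
  | pred n ih =>
    have e : cocycle α φ (-n - 1) = fun x => cocycle α φ (-n) (x - (α : AddCircle (1 : ℝ)))
        - φ (x - (α : AddCircle (1 : ℝ))) := by
      funext x
      have h := cocycle_add α φ (-n - 1) 1 (x - (α : AddCircle (1 : ℝ)))
      rw [sub_add_cancel, cocycle_one, one_smul, sub_add_cancel] at h
      linarith
    rw [e]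
    fun_prop

theorem dense_orbit_nat {α : ℝ} (hα : Irrational α) (x : AddCircle (1 : ℝ)) :
    DenseRange fun n : ℕ => x + n • (α : AddCircle (1 : ℝ)) := by
  have h : DenseRange fun n : ℤ => n • (α : AddCircle (1 : ℝ)) := by
    rw [AddCircle.denseRange_zsmul_coe_iff]
    simpa using hα
  exact (Homeomorph.addLeft x).surjective.denseRange.comp (denseRange_zsmul_iff_nsmul.1 h)
    (Homeomorph.addLeft x).continuous

/-- A lower semicontinuous function invariant under an irrational rotation is constant. -/
theorem LowerSemicontinuous.eq_of_rotation_invariant {α : ℝ} (hα : Irrational α)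
    {f : AddCircle (1 : ℝ) → ℝ} (hf : LowerSemicontinuous f)
    (hinv : ∀ x, f (x + (α : AddCircle (1 : ℝ))) = f x) (x y : AddCircle (1 : ℝ)) :
    f x = f y := by
  have hle : ∀ x y, f y ≤ f x := by
    intro x y
    have horb : ∀ n : ℕ, f (x + n • (α : AddCircle (1 : ℝ))) = f x := by
      intro n
      induction n with
      | zero => simp
      | succ n ih => rw [succ_nsmul, ← add_assoc, hinv, ih]
    have hcl : IsClosed {z | f z ≤ f x} := hf.isClosed_preimage (f x)
    exact (dense_orbit_nat hα x).induction_on (p := fun z => f z ≤ f x) y hcl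
      fun n => (horb n).le
  exact le_antisymm (hle y x) (hle x y)

/-- The Gottschalk–Hedlund theorem for an irrational rotation: if the Birkhoff sums of one point
are bounded in forward time, then the cohomological equation has a continuous solution. -/
theorem exists_continuous_transfer_of_bounded {α : ℝ} (hα : Irrational α)
    {φ : AddCircle (1 : ℝ) → ℝ} (hφ : Continuous φ) {x : AddCircle (1 : ℝ)} {C : ℝ}
    (hC : ∀ n : ℕ, |cocycle α φ n x| ≤ C) :
    ∃ h : AddCircle (1 : ℝ) → ℝ, Continuous h ∧
      ∀ x, h (x + (α : AddCircle (1 : ℝ))) - h x = φ x := by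
  have hnat : ∀ (n : ℕ) y, |cocycle α φ n y| ≤ 2 * C := by
    intro n y
    refine (dense_orbit_nat hα x).induction_on (p := fun y => |cocycle α φ n y| ≤ 2 * C) y
      (isClosed_le (continuous_cocycle α hφ n).abs continuous_const) fun m => ?_
    have h1 := cocycle_add α φ n m x
    rw [natCast_zsmul, ← Nat.cast_add] at h1
    have h2 : cocycle α φ n (x + m • (α : AddCircle (1 : ℝ)))
        = cocycle α φ (n + m : ℕ) x - cocycle α φ m x := by linarith
    rw [h2]
    exact (abs_sub _ _).trans (by linarith [hC (n + m), hC m])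
  have hint : ∀ (n : ℤ) y, |cocycle α φ n y| ≤ 2 * C := by
    intro n y
    obtain ⟨m, rfl | rfl⟩ := n.eq_nat_or_neg
    · exact hnat m y
    · have h1 := cocycle_add α φ m (-m) y
      rw [add_neg_cancel, cocycle_zero] at h1
      rw [show cocycle α φ (-m) y = -cocycle α φ m (y + (-m : ℤ) • (α : AddCircle (1 : ℝ))) by
        linarith, abs_neg]
      exact hnat m _
  have hba : ∀ y, BddAbove (Set.range fun n => cocycle α φ n y) := fun y =>
    ⟨2 * C, by rintro _ ⟨n, rfl⟩; exact (abs_le.1 (hint n y)).2⟩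
  have hbb : ∀ y, BddBelow (Set.range fun n => cocycle α φ n y) := fun y =>
    ⟨-(2 * C), by rintro _ ⟨n, rfl⟩; exact (abs_le.1 (hint n y)).1⟩
  have hshift : ∀ n y, cocycle α φ n (y + (α : AddCircle (1 : ℝ)))
      = cocycle α φ (n + 1) y - φ y := by
    intro n y
    rw [cocycle_add, cocycle_one, one_smul]; ring
  set M : AddCircle (1 : ℝ) → ℝ := fun y => ⨆ n, cocycle α φ n y with hM
  set m : AddCircle (1 : ℝ) → ℝ := fun y => ⨅ n, cocycle α φ n y with hm
  have hMs : ∀ y, M (y + (α : AddCircle (1 : ℝ))) = M y - φ y := by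
    intro y
    simp only [hM, hshift]
    rw [← (Equiv.addRight (1 : ℤ)).iSup_comp (g := fun n => cocycle α φ n y),
      ciSup_sub]
    · rfl
    · exact (hba y).mono (by rintro _ ⟨n, rfl⟩; exact ⟨n + 1, rfl⟩)
  have hms : ∀ y, m (y + (α : AddCircle (1 : ℝ))) = m y - φ y := by
    intro y
    simp only [hm, hshift]
    rw [← (Equiv.addRight (1 : ℤ)).iInf_comp (g := fun n => cocycle α φ n y),
      ciInf_sub]
    · rfl
    · exact (hbb y).mono (by rintro _ ⟨n, rfl⟩; exact ⟨n + 1, rfl⟩)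
  have hMl : LowerSemicontinuous M := lowerSemicontinuous_ciSup hba fun n =>
    (continuous_cocycle α hφ n).lowerSemicontinuous
  have hmu : UpperSemicontinuous m := upperSemicontinuous_ciInf hbb fun n =>
    (continuous_cocycle α hφ n).upperSemicontinuous
  have hml : LowerSemicontinuous fun y => -m y := fun y c hc => by
    filter_upwards [hmu y (-c) (by linarith)] with z hz
    linarith
  have hconst := (hMl.add hml).eq_of_rotation_invariant hα (fun y => by rw [hMs, hms]; ring)
  have hMu : UpperSemicontinuous M := by
    have e : M = fun y => m y + (M x + -m x) := by
      funext y
      linarith [hconst y x]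
    rw [e]
    exact hmu.add continuous_const.upperSemicontinuous
  refine ⟨fun y => -M y, (continuous_iff_lower_upperSemicontinuous.2 ⟨hMl, hMu⟩).neg,
    fun y => ?_⟩
  linarith [hMs y]

/-- Almost-return times at which the cocycle takes a value of size between `a` and `b`. -/
theorem exists_return_cocycle_mem {α : ℝ} {φ : AddCircle (1 : ℝ) → ℝ} (h : AnzaiConds α φ)
    (x : AddCircle (1 : ℝ)) {a b : ℝ} (ha : 0 < a) (hab : a < b) {ε : ℝ} (hε : 0 < ε) :
    ∃ (n : ℕ) (m : ℤ), |n * α - m| < ε ∧ |cocycle α φ n x| ∈ Set.Icc a b := by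
  obtain ⟨hα, hφ, h0, hcob, hac⟩ := h
  by_contra! hno
  obtain ⟨ε₁, hε₁, hsmall⟩ := hac.birkhoff_small hφ h0 hα (sub_pos.2 hab)
  obtain ⟨⟨P, p, hP, hP0, hPε⟩, Q, r, hQ, hQ0, hQε⟩ :=
    exists_isGoodApprox_pos_neg hα (lt_min hε hε₁)
  have hPs : ∀ y, |cocycle α φ P y| ≤ b - a := fun y => by
    rw [cocycle_natCast]
    exact hsmall P p hP (by rw [abs_of_pos hP0]; exact hPε.trans_le (min_le_right _ _)) y
  have hQs : ∀ y, |cocycle α φ Q y| ≤ b - a := fun y => by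
    rw [cocycle_natCast]
    refine hsmall Q r hQ ?_ y
    rw [abs_of_neg hQ0]
    linarith [min_le_right ε ε₁]
  have hPε' : P * α - p < ε := hPε.trans_le (min_le_left _ _)
  have hQε' : -ε < Q * α - r := by linarith [min_le_left ε ε₁]
  have hstep : ∀ (n R : ℕ) (k : ℤ), |cocycle α φ n x| < a →
      (∀ y, |cocycle α φ R y| ≤ b - a) → |((n + R : ℕ) : ℝ) * α - k| < ε →
      |cocycle α φ (n + R : ℕ) x| < a := by
    intro n R k hn hR hk
    by_contra! hge
    refine hno (n + R) k hk ⟨hge, ?_⟩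
    rw [add_comm n R, Nat.cast_add, cocycle_add]
    exact (abs_add_le _ _).trans (by linarith [hR (x + (n : ℤ) • (α : AddCircle (1 : ℝ)))])
  have hpath : ∀ N : ℕ, ∃ (n : ℕ) (k : ℤ), n ≤ N ∧ N ≤ n + (P + Q) ∧ |n * α - k| < ε ∧
      |cocycle α φ n x| < a := by
    intro N
    induction N with
    | zero => exact ⟨0, 0, le_rfl, Nat.zero_le _, by simpa using hε, by simpa [cocycle_zero]⟩
    | succ N ih =>
      obtain ⟨n, k, hnN, hNn, hk, hn⟩ := ih
      by_cases hle : N + 1 ≤ n + (P + Q)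
      · exact ⟨n, k, by omega, hle, hk, hn⟩
      have hPpos := hP.1
      have hQpos := hQ.1
      rw [abs_lt] at hk
      rcases le_or_gt (n * α - k) 0 with hs | hs
      · have hk' : |((n + P : ℕ) : ℝ) * α - ((k + p : ℤ) : ℝ)| < ε := by
          push_cast
          rw [abs_lt]
          constructor <;> linarith
        exact ⟨n + P, k + p, by omega, by omega, hk', hstep n P _ hn hPs hk'⟩
      · have hk' : |((n + Q : ℕ) : ℝ) * α - ((k + r : ℤ) : ℝ)| < ε := by
          push_cast
          rw [abs_lt]
          constructor <;> linarith
        exact ⟨n + Q, k + r, by omega, by omega, hk', hstep n Q _ hn hQs hk'⟩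
  obtain ⟨K, hK⟩ : ∃ K, ∀ y, |φ y| ≤ K := by
    obtain ⟨K, hK⟩ := isCompact_univ.exists_bound_of_continuousOn hφ.continuousOn
    exact ⟨K, fun y => hK y (Set.mem_univ y)⟩
  have hK0 : 0 ≤ K := (abs_nonneg _).trans (hK x)
  refine hcob (exists_continuous_transfer_of_bounded hα hφ (x := x) (C := a + (P + Q : ℕ) * K)
    fun N => ?_)
  obtain ⟨n, k, hnN, hNn, -, hn⟩ := hpath N
  obtain ⟨d, rfl⟩ := Nat.exists_eq_add_of_le hnN
  rw [add_comm n d, Nat.cast_add, cocycle_add]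
  refine (abs_add_le _ _).trans (add_le_add hn.le ?_)
  rw [cocycle_natCast]
  refine (Finset.abs_sum_le_sum_abs _ _).trans ((Finset.sum_le_sum fun j _ => hK _).trans ?_)
  rw [Finset.sum_const, Finset.card_range, nsmul_eq_mul]
  gcongr
  omega

theorem natCast_mul_coe_ne_zero {α : ℝ} (hα : Irrational α) {n : ℕ} (hn : n ≠ 0) :
    ((n * α : ℝ) : AddCircle (1 : ℝ)) ≠ 0 := by
  intro h
  obtain ⟨m, hm⟩ := (AddCircle.coe_eq_zero_iff 1).1 h
  simp only [zsmul_eq_mul, mul_one] at hm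
  have hn' : (n : ℝ) ≠ 0 := by exact_mod_cast hn
  exact hα ⟨m / n, by push_cast; field_simp; linarith⟩

/-- For every `x` and all `0 < a < b`, the set `𝓛_x` meets `[-b,-a] ∪ [a,b]`. -/
theorem stmt_9 (α : ℝ) (φ : AddCircle (1 : ℝ) → ℝ) (h : AnzaiConds α φ)
    (x : AddCircle (1 : ℝ)) (a b : ℝ) (ha : 0 < a) (hab : a < b) :
    (Lx α φ x ∩ (Set.Icc (-b) (-a) ∪ Set.Icc a b)).Nonempty := by
  have hret := fun k : ℕ => exists_return_cocycle_mem h x ha hab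
    (Nat.one_div_pos_of_nat (α := ℝ) (n := k))
  choose n m hnm hmem using hret
  have hmem' : ∀ k, cocycle α φ (n k) x ∈ Set.Icc (-b) (-a) ∪ Set.Icc a b := by
    intro k
    obtain ⟨h1, h2⟩ := hmem k
    rcases le_abs.1 h1 with h3 | h3
    · exact Or.inr ⟨h3, (le_abs_self _).trans h2⟩
    · exact Or.inl ⟨by linarith [(abs_le.1 h2).1], by linarith⟩
  obtain ⟨y, hy, ψ, hψ, hlim⟩ :=
    (isCompact_Icc.union isCompact_Icc).tendsto_subseq hmem'
  have hzero : Tendsto (fun k => ((n k * α : ℝ) : AddCircle (1 : ℝ))) atTop (𝓝 0) := by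
    have h1 : Tendsto (fun k => (n k * α - m k : ℝ)) atTop (𝓝 0) :=
      squeeze_zero_norm (fun k => (hnm k).le) tendsto_one_div_add_atTop_nhds_zero_nat
    have h2 := ((AddCircle.continuous_mk' (1 : ℝ)).tendsto 0).comp h1
    refine h2.congr fun k => ?_
    have : ((m k : ℝ) : AddCircle (1 : ℝ)) = 0 :=
      (AddCircle.coe_eq_zero_iff 1).2 ⟨m k, by simp⟩
    change ((n k * α - m k : ℝ) : AddCircle (1 : ℝ)) = _
    rw [AddCircle.coe_sub, this, sub_zero]
  have hn : Tendsto n atTop atTop := by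
    have hne : ∀ i : ℕ, ∀ᶠ k in atTop, n k ≠ i := by
      intro i
      rcases eq_or_ne i 0 with rfl | hi
      · refine Eventually.of_forall fun k hk => ?_
        have := (hmem k).1
        rw [hk, Nat.cast_zero, cocycle_zero, abs_zero] at this
        linarith
      · filter_upwards [hzero.eventually_ne (natCast_mul_coe_ne_zero h.1 hi).symm] with k hk hki
        exact hk (by rw [hki])
    refine tendsto_atTop.2 fun N => ?_
    filter_upwards [(Finset.range N).eventually_all.2 fun i _ => hne i] with k hk
    by_contra! hlt
    exact hk (n k) (Finset.mem_range.2 hlt) rfl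
  refine ⟨y, ⟨fun k => n (ψ k), ?_, ?_⟩, hy⟩
  · simp only [Nat.abs_cast]
    exact tendsto_natCast_atTop_atTop.comp (hn.comp hψ.tendsto_atTop)
  · simp_rw [anzai_zpow_apply]
    refine Tendsto.prodMk_nhds ?_ (by simpa [Function.comp_def] using hlim)
    have := (hzero.comp hψ.tendsto_atTop).const_add x
    rw [add_zero] at this
    refine this.congr fun k => ?_
    simp only [Function.comp_apply, natCast_zsmul, ← AddCircle.coe_nsmul, nsmul_eq_mul]
end
end
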